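/- Let Ω̄ be a d×d correlation matrix (symmetric positive definite with unit diagonal), α ∈ ℝ^d, τ, κ ∈ ℝ and ν > 0. Let (X, X₀) be an ℝ^d × ℝ-valued random vector whose joint density is the (d+1)-dimensional non-central t density with location 0, scale the block-diagonal matrix diag(Ω̄, 1), non-centrality vector (0, …, 0, κ) and ν degrees of freedom, i.e. the density at (x, x₀) equals ∫_0^∞ [v^{ν/2−1} e^{−v}/Γ(ν/2)] (2v/ν)^{(d+1)/2} φ_d(√(2v/ν) x; Ω̄) φ(√(2v/ν) x₀ − κ) dv. Then P(αᵀX + τ > X₀) > 0 and, for every Borel set B ⊆ ℝ^d, P(X ∈ B and αᵀX + τ > X₀) / P(αᵀX + τ > X₀) = ∫_B ψ_d(y; 0, Ω̄, α, τ, κ, ν) dy, where ψ_d is the non-central extended skew-t density; that is, the conditional law of X given αᵀX + τ > X₀ is the non-central extended skew-t distribution with parameters (Ω̄, α, τ, κ, ν). -/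

import Mathlib

open MeasureTheory Real Filter Matrix Set Topology Asymptotics

noncomputable section

/-- Standard normal density. -/
def nPdf (x : ℝ) : ℝ := (Real.sqrt (2 * π))⁻¹ * Real.exp (-(x ^ 2) / 2)

/-- Standard normal distribution function. -/
def nCdf (x : ℝ) : ℝ := ∫ u in Set.Iio x, nPdf u

/-- Centred multivariate normal density with covariance matrix `S`. -/
def mvnPdf {ι : Type*} [Fintype ι] [DecidableEq ι] (S : Matrix ι ι ℝ) (y : ι → ℝ) : ℝ :=
  (2 * π) ^ (-(Fintype.card ι : ℝ) / 2) * S.det ^ (-(1 : ℝ) / 2) *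
    Real.exp (-(y ⬝ᵥ S⁻¹.mulVec y) / 2)

/-- Centred multivariate normal distribution function. -/
def mvnCdf {ι : Type*} [Fintype ι] [DecidableEq ι] (S : Matrix ι ι ℝ) (w : ι → ℝ) : ℝ :=
  ∫ u in Set.univ.pi fun i => Set.Iic (w i), mvnPdf S u

/-- Multivariate central Student-t density with scale matrix `S` and `ν` degrees of freedom. -/
def tPdf {ι : Type*} [Fintype ι] [DecidableEq ι] (S : Matrix ι ι ℝ) (ν : ℝ) (y : ι → ℝ) : ℝ :=
  Real.Gamma ((ν + Fintype.card ι) / 2) *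
      (1 + y ⬝ᵥ S⁻¹.mulVec y / ν) ^ (-(ν + Fintype.card ι) / 2) /
    (Real.Gamma (ν / 2) * (ν * π) ^ ((Fintype.card ι : ℝ) / 2) * Real.sqrt S.det)

/-- Univariate non-central t distribution function with non-centrality `a`. -/
def nctCdf (x a ν : ℝ) : ℝ :=
  ∫ v in Set.Ioi (0 : ℝ),
    v ^ (ν / 2 - 1) * Real.exp (-v) / Real.Gamma (ν / 2) *
      nCdf (x * Real.sqrt (2 * v / ν) - a)

/-- Multivariate non-central t distribution function. -/
def mvnctCdf {ι : Type*} [Fintype ι] [DecidableEq ι]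
    (y : ι → ℝ) (S : Matrix ι ι ℝ) (κ : ι → ℝ) (ν : ℝ) : ℝ :=
  ∫ v in Set.Ioi (0 : ℝ),
    v ^ (ν / 2 - 1) * Real.exp (-v) / Real.Gamma (ν / 2) *
      mvnCdf S fun i => y i * Real.sqrt (2 * v / ν) - κ i

/-- Multivariate non-central t density (scale-mixture form). -/
def mvnctPdf {ι : Type*} [Fintype ι] [DecidableEq ι]
    (μ : ι → ℝ) (S : Matrix ι ι ℝ) (κ : ι → ℝ) (ν : ℝ) (y : ι → ℝ) : ℝ :=
  ∫ v in Set.Ioi (0 : ℝ),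
    v ^ (ν / 2 - 1) * Real.exp (-v) / Real.Gamma (ν / 2) *
      ((2 * v / ν) ^ ((Fintype.card ι : ℝ) / 2) *
        mvnPdf S fun i => Real.sqrt (2 * v / ν) * (y i - μ i) - κ i)

/-- Univariate non-central t density with location `μ`, scale (standard deviation) `s`,
non-centrality `κ` and `ν` degrees of freedom. -/
def nctPdf1 (μ s κ ν x : ℝ) : ℝ :=
  ∫ v in Set.Ioi (0 : ℝ),
    v ^ (ν / 2 - 1) * Real.exp (-v) / Real.Gamma (ν / 2) *
      (Real.sqrt (2 * v / ν) * s⁻¹ * nPdf (Real.sqrt (2 * v / ν) * (x - μ) / s - κ))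

/-- Non-central extended skew-t density. -/
def skewTPdf {ι : Type*} [Fintype ι] [DecidableEq ι]
    (μ : ι → ℝ) (Ω : Matrix ι ι ℝ) (α : ι → ℝ) (τ κ ν : ℝ) (y : ι → ℝ) : ℝ :=
  let d : ℝ := Fintype.card ι
  let ω : Matrix ι ι ℝ := Matrix.diagonal fun i => Real.sqrt (Ω i i)
  let Ωb : Matrix ι ι ℝ := ω⁻¹ * Ω * ω⁻¹
  let z : ι → ℝ := ω⁻¹.mulVec fun i => y i - μ i
  let Q : ℝ := α ⬝ᵥ Ωb.mulVec α
  tPdf Ω ν (fun i => y i - μ i) *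
      nctCdf ((α ⬝ᵥ z + τ) * Real.sqrt ((ν + d) / (ν + z ⬝ᵥ Ωb⁻¹.mulVec z))) κ (ν + d) /
    nctCdf (τ / Real.sqrt (1 + Q)) (κ / Real.sqrt (1 + Q)) ν

/-- Non-central extended skew-t distribution function. -/
def skewTCdf {ι : Type*} [Fintype ι] [DecidableEq ι]
    (μ : ι → ℝ) (Ω : Matrix ι ι ℝ) (α : ι → ℝ) (τ κ ν : ℝ) (y : ι → ℝ) : ℝ :=
  ∫ u in Set.univ.pi fun i => Set.Iic (y i), skewTPdf μ Ω α τ κ ν u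



open ProbabilityTheory

lemma aux_nPdf_eq (x : ℝ) : nPdf x = gaussianPDFReal 0 1 x := by
  simp [nPdf, gaussianPDFReal]

lemma aux_nPdf_pos (x : ℝ) : 0 < nPdf x := by
  rw [aux_nPdf_eq]; exact gaussianPDFReal_pos _ _ _ (by simp)

lemma aux_ofReal_nCdf (x : ℝ) : ENNReal.ofReal (nCdf x) = gaussianReal 0 1 (Iio x) := by
  rw [gaussianReal_apply_eq_integral _ (by simp), nCdf]
  simp_rw [aux_nPdf_eq]

lemma aux_nCdf_nonneg (x : ℝ) : 0 ≤ nCdf x :=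
  integral_nonneg fun u => (aux_nPdf_pos u).le

lemma aux_nCdf_eq (x : ℝ) : nCdf x = (gaussianReal 0 1 (Iio x)).toReal := by
  rw [← aux_ofReal_nCdf, ENNReal.toReal_ofReal (aux_nCdf_nonneg x)]

lemma aux_nCdf_le_one (x : ℝ) : nCdf x ≤ 1 := by
  rw [aux_nCdf_eq]
  exact ENNReal.toReal_le_of_le_ofReal zero_le_one (by simpa using prob_le_one)

lemma aux_nCdf_pos (x : ℝ) : 0 < nCdf x := by
  have h : 0 < ENNReal.ofReal (nCdf x) := by
    rw [aux_ofReal_nCdf, pos_iff_ne_zero]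
    intro h
    have := gaussianReal_absolutelyContinuous' 0 (v := 1) (by simp) h
    simp at this
  simpa using h

lemma aux_measurable_nCdf : Measurable nCdf := by
  apply Monotone.measurable
  intro a b hab
  rw [aux_nCdf_eq, aux_nCdf_eq]
  exact ENNReal.toReal_mono (measure_ne_top _ _) (measure_mono (Iio_subset_Iio hab))

lemma aux_measurable_nPdf : Measurable nPdf := by
  unfold nPdf; fun_prop

lemma aux_measurable_mvnPdf {d : ℕ} (S : Matrix (Fin d) (Fin d) ℝ) : Measurable (mvnPdf S) := by
  have : Continuous (mvnPdf S) := by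
    unfold mvnPdf
    fun_prop
  exact this.measurable

/-- scaled one-dimensional integral -/
lemma aux_inner (s κ c : ℝ) (hs : 0 < s) :
    ∫⁻ x in Iio c, ENNReal.ofReal (s * nPdf (s * x - κ)) = ENNReal.ofReal (nCdf (s * c - κ)) := by
  have h1 : (gaussianReal 0 1).map (fun u => s⁻¹ * (u + κ)) =
      gaussianReal (s⁻¹ * κ) (.mk (s⁻¹ ^ 2) (sq_nonneg _) * 1) := by
    have := Measure.map_map (μ := gaussianReal 0 1) (g := fun u => s⁻¹ * u) (f := fun u => u + κ)
      (by fun_prop) (by fun_prop)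
    rw [gaussianReal_map_add_const, gaussianReal_map_const_mul, zero_add] at this
    exact this.symm
  have h2 := congrArg (fun m => m (Iio c)) h1
  rw [Measure.map_apply (by fun_prop) measurableSet_Iio, gaussianReal_apply (s⁻¹ * κ)] at h2
  · have h3 : (fun u => s⁻¹ * (u + κ)) ⁻¹' Iio c = Iio (s * c - κ) := by
      ext u
      simp only [mem_preimage, mem_Iio]
      rw [inv_mul_lt_iff₀ hs, lt_sub_iff_add_lt]
    rw [h3] at h2
    rw [aux_ofReal_nCdf, h2]
    refine lintegral_congr fun x => ?_
    rw [gaussianPDF]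
    congr 1
    simp only [nPdf, gaussianPDFReal, mul_one, NNReal.coe_mk]
    have : √(2 * π * (s⁻¹ ^ 2)) = √(2 * π) * s⁻¹ := by
      rw [Real.sqrt_mul (by positivity), Real.sqrt_sq (by positivity)]
    have e : -(s * x - κ) ^ 2 / 2 = -(x - s⁻¹ * κ) ^ 2 / (2 * s⁻¹ ^ 2) := by
      field_simp
    change _ = (√(2 * π * (s⁻¹ ^ 2)))⁻¹ * rexp (-(x - s⁻¹ * κ) ^ 2 / (2 * s⁻¹ ^ 2))
    rw [this, e, mul_inv, inv_inv]
    ring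
  · intro h
    have := congrArg NNReal.toReal h
    change s⁻¹ ^ 2 * 1 = 0 at this
    have : 0 < s⁻¹ := by positivity
    simp_all

/-- standard Gaussian density on ℝ^d -/
def auxStd {d : ℕ} (z : Fin d → ℝ) : ℝ :=
  (2 * π) ^ (-(d : ℝ) / 2) * Real.exp (-(z ⬝ᵥ z) / 2)

lemma aux_continuous_std {d : ℕ} : Continuous (auxStd (d := d)) := by
  unfold auxStd; fun_prop

lemma aux_std_pos {d : ℕ} (z : Fin d → ℝ) : 0 < auxStd z := by
  unfold auxStd; positivity

lemma aux_charFun {d : ℕ} (β : Fin d → ℝ) (t : ℝ) :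
    ∫ z : Fin d → ℝ, ((auxStd z : ℝ) : ℂ) * Complex.exp (t * (-(β ⬝ᵥ z) : ℝ) * Complex.I) =
      Complex.exp (- ((β ⬝ᵥ β : ℝ) : ℂ) * t ^ 2 / 2) := by
  have h := GaussianFourier.integral_cexp_neg_mul_sum_add (ι := Fin d) (b := 1/2) (by norm_num)
    (fun i => -(t * β i * Complex.I))
  have e : ∀ z : Fin d → ℝ, ((auxStd z : ℝ) : ℂ) * Complex.exp (t * (-(β ⬝ᵥ z) : ℝ) * Complex.I) =
     (((2 * π) ^ (-(d : ℝ) / 2) : ℝ) : ℂ) * Complex.exp (-(1/2) * ∑ i, (z i : ℂ) ^ 2 + ∑ i, (-(t * β i * Complex.I)) * z i) := by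
    intro z
    rw [auxStd, Complex.ofReal_mul, mul_assoc, Complex.ofReal_exp, ← Complex.exp_add]
    congr 2
    simp only [dotProduct]
    push_cast
    rw [Finset.mul_sum, neg_div, Finset.sum_div, ← Finset.sum_neg_distrib, ← Finset.sum_neg_distrib, Finset.mul_sum, Finset.sum_mul]
    congr 1
    · exact Finset.sum_congr rfl fun i _ => by ring
    · exact Finset.sum_congr rfl fun i _ => by ring
  simp_rw [e]
  rw [integral_const_mul, h, ← mul_assoc]
  have e2 : (((2 * π) ^ (-(d : ℝ) / 2) : ℝ) : ℂ) * (π / (1/2)) ^ ((Fintype.card (Fin d) : ℂ) / 2) = 1 := by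
    have : ((π : ℂ) / (1/2)) ^ ((Fintype.card (Fin d) : ℂ) / 2) = (((2 * π) ^ ((d : ℝ) / 2) : ℝ) : ℂ) := by
      rw [Complex.ofReal_cpow (by positivity)]
      push_cast
      rw [Fintype.card_fin]
      congr 1
      ring
    rw [this, ← Complex.ofReal_mul, ← Real.rpow_add (by positivity)]
    simp [neg_div]
  rw [e2, one_mul]
  congr 1
  simp only [dotProduct]
  push_cast
  rw [Finset.sum_div, neg_mul, neg_div, Finset.sum_mul, Finset.sum_div, ← Finset.sum_neg_distrib]
  refine Finset.sum_congr rfl fun i _ => ?_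
  ring_nf
  simp
  ring

lemma aux_std_integrable {d : ℕ} : Integrable (auxStd (d := d)) := by
  have h := aux_charFun (d := d) 0 0
  by_contra hc
  simp only [Complex.ofReal_zero, zero_mul, Complex.exp_zero, mul_one] at h
  rw [integral_undef] at h
  · simp at h
  · intro h2
    exact hc (by simpa using h2.re)

lemma aux_std_map {d : ℕ} (β : Fin d → ℝ) :
    (volume.withDensity fun z : Fin d → ℝ => ENNReal.ofReal (auxStd z)).map (fun z => -(β ⬝ᵥ z)) =
      gaussianReal 0 (β ⬝ᵥ β).toNNReal := by
  have hm : Measurable (fun z : Fin d → ℝ => -(β ⬝ᵥ z)) := by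
    have : Continuous (fun z : Fin d → ℝ => -(β ⬝ᵥ z)) := by fun_prop
    exact this.measurable
  have : IsFiniteMeasure (volume.withDensity fun z : Fin d → ℝ => ENNReal.ofReal (auxStd z)) :=
    isFiniteMeasure_withDensity_ofReal aux_std_integrable.2
  refine Measure.ext_of_charFun ?_
  ext t
  rw [charFun_gaussianReal, charFun_apply_real, integral_map hm.aemeasurable (by fun_prop),
    integral_withDensity_eq_integral_toReal_smul (by exact aux_continuous_std.measurable.ennreal_ofReal) (by simp)]
  have h0 : 0 ≤ β ⬝ᵥ β := by
    simp only [dotProduct]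
    exact Finset.sum_nonneg fun i _ => mul_self_nonneg _
  convert aux_charFun β t using 1
  · refine integral_congr_ae (Eventually.of_forall fun z => ?_)
    simp [ENNReal.toReal_ofReal (aux_std_pos z).le]
  · congr 1
    simp [Real.coe_toNNReal _ h0, neg_div]

lemma aux_std_phi {d : ℕ} (β : Fin d → ℝ) (c : ℝ) :
    ∫⁻ z : Fin d → ℝ, ENNReal.ofReal (auxStd z) * ENNReal.ofReal (nCdf (β ⬝ᵥ z + c)) =
      ENNReal.ofReal (nCdf (c / √(1 + β ⬝ᵥ β))) := by
  have hm : Measurable (fun z : Fin d → ℝ => -(β ⬝ᵥ z)) := by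
    have : Continuous (fun z : Fin d → ℝ => -(β ⬝ᵥ z)) := by fun_prop
    exact this.measurable
  have h0 : 0 ≤ β ⬝ᵥ β := by
    simp only [dotProduct]
    exact Finset.sum_nonneg fun i _ => mul_self_nonneg _
  have hmc : Measurable fun w : ℝ => ENNReal.ofReal (nCdf (c - w)) :=
    (aux_measurable_nCdf.comp (by fun_prop)).ennreal_ofReal
  have h1 : ∫⁻ z : Fin d → ℝ, ENNReal.ofReal (auxStd z) * ENNReal.ofReal (nCdf (β ⬝ᵥ z + c)) =
      ∫⁻ w, ENNReal.ofReal (nCdf (c - w)) ∂(gaussianReal 0 (β ⬝ᵥ β).toNNReal) := by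
    rw [← aux_std_map, lintegral_map hmc hm,
      lintegral_withDensity_eq_lintegral_mul _ (by exact aux_continuous_std.measurable.ennreal_ofReal) (by exact hmc.comp hm)]
    refine lintegral_congr fun z => ?_
    simp only [Pi.mul_apply, sub_neg_eq_add, add_comm]
  rw [h1]
  have h3 := congrArg (fun m => m (Iio c)) (gaussianReal_conv_gaussianReal (m₁ := 0) (m₂ := 0) (v₁ := (β ⬝ᵥ β).toNNReal) (v₂ := 1))
  rw [Measure.conv, Measure.map_apply (by fun_prop) measurableSet_Iio,
    Measure.prod_apply (by measurability)] at h3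
  have h4 : ∀ w, ENNReal.ofReal (nCdf (c - w)) = gaussianReal 0 1 (Prod.mk w ⁻¹' ((fun x : ℝ × ℝ => x.1 + x.2) ⁻¹' Iio c)) := by
    intro w
    rw [aux_ofReal_nCdf]
    congr 1
    ext x
    simp [lt_sub_iff_add_lt, add_comm]
  simp_rw [h4]
  rw [h3, aux_ofReal_nCdf]
  set r := √(1 + β ⬝ᵥ β) with hr
  have hrpos : 0 < r := by positivity
  have h5 := congrArg (fun m => m (Iio c)) (gaussianReal_map_const_mul (μ := 0) (v := 1) r)
  rw [Measure.map_apply (by fun_prop) measurableSet_Iio] at h5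
  have h6 : (fun x => r * x) ⁻¹' Iio c = Iio (c / r) := by
    ext x
    simp [lt_div_iff₀' hrpos]
  rw [h6] at h5
  rw [h5]
  congr 2
  · simp
  · ext
    have : (r ^ 2 : ℝ) = 1 + β ⬝ᵥ β := Real.sq_sqrt (by positivity)
    push_cast
    rw [Real.coe_toNNReal _ h0]
    change _ = r ^ 2 * 1
    rw [this]; ring

lemma aux_factor {d : ℕ} (S : Matrix (Fin d) (Fin d) ℝ) (hS : S.PosDef) :
    ∃ B : Matrix (Fin d) (Fin d) ℝ, S = Bᵀ * B := by
  open scoped MatrixOrder in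
  obtain ⟨B, hB⟩ := CStarAlgebra.nonneg_iff_eq_star_mul_self.1 hS.posSemidef.nonneg
  exact ⟨B, by simpa [Matrix.star_eq_conjTranspose] using hB⟩

lemma aux_change {d : ℕ} (S : Matrix (Fin d) (Fin d) ℝ) (hS : S.PosDef)
    (B : Matrix (Fin d) (Fin d) ℝ) (hB : S = Bᵀ * B) (s : ℝ) (hs : 0 < s)
    (f : (Fin d → ℝ) → ENNReal) (hf : Measurable f) :
    ∫⁻ x, ENNReal.ofReal (s ^ d * mvnPdf S (fun i => s * x i)) * f x =
      ∫⁻ z, ENNReal.ofReal (auxStd z) * f (s⁻¹ • (Bᵀ *ᵥ z)) := by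
  have hdet : S.det = B.det ^ 2 := by rw [hB, det_mul, det_transpose]; ring
  have hB0 : B.det ≠ 0 := by
    intro h
    have := hS.det_pos
    rw [hdet, h] at this
    simp at this
  have hBu : IsUnit B.det := isUnit_iff_ne_zero.2 hB0
  set M : Matrix (Fin d) (Fin d) ℝ := s⁻¹ • Bᵀ with hM
  have hMdet : M.det = (s⁻¹) ^ d * B.det := by
    rw [hM, det_smul, det_transpose, Fintype.card_fin]
  have hM0 : M.det ≠ 0 := by rw [hMdet]; positivity
  have hmap := Real.map_matrix_volume_pi_eq_smul_volume_pi hM0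
  have hMm : Measurable (toLin' M) := (toLin' M).continuous_of_finiteDimensional.measurable
  have hvol : (volume : Measure (Fin d → ℝ)) = ENNReal.ofReal |M.det| • Measure.map (toLin' M) volume := by
    rw [hmap, smul_smul, ← ENNReal.ofReal_mul (abs_nonneg _), ← abs_mul, mul_inv_cancel₀ hM0]
    simp
  have hgm : Measurable fun x : Fin d → ℝ => ENNReal.ofReal (s ^ d * mvnPdf S (fun i => s * x i)) * f x :=
    (((aux_measurable_mvnPdf S).comp (by fun_prop)).const_mul _).ennreal_ofReal.mul hf
  conv_lhs => rw [hvol]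
  rw [lintegral_smul_measure, lintegral_map hgm hMm, smul_eq_mul,
    ← lintegral_const_mul _ (by exact hgm.comp hMm)]
  refine lintegral_congr fun z => ?_
  have e1 : toLin' M z = s⁻¹ • (Bᵀ *ᵥ z) := by
    rw [toLin'_apply, hM, smul_mulVec]
  rw [e1, ← mul_assoc, ← ENNReal.ofReal_mul (abs_nonneg _)]
  congr 2
  have e2 : (fun i => s * (s⁻¹ • (Bᵀ *ᵥ z)) i) = Bᵀ *ᵥ z := by
    ext i; simp [hs.ne']
  have e3 : (Bᵀ *ᵥ z) ⬝ᵥ S⁻¹ *ᵥ (Bᵀ *ᵥ z) = z ⬝ᵥ z := by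
    have hBtu : IsUnit (Bᵀ).det := by rwa [det_transpose]
    rw [hB, Matrix.mul_inv_rev, mulVec_mulVec, Matrix.mul_assoc, nonsing_inv_mul _ hBtu, Matrix.mul_one,
      mulVec_transpose, ← dotProduct_mulVec, mulVec_mulVec, mul_nonsing_inv _ hBu, one_mulVec]
  rw [e2, mvnPdf, e3, auxStd, hMdet, hdet, Fintype.card_fin, abs_mul, abs_of_pos (by positivity)]
  have e4 : (B.det ^ 2) ^ (-(1:ℝ) / 2) = |B.det|⁻¹ := by
    rw [← sq_abs, ← Real.rpow_natCast, ← Real.rpow_mul (abs_nonneg _)]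
    norm_num [Real.rpow_neg_one]
  rw [e4]
  have : |B.det| ≠ 0 := by positivity
  field_simp
  rw [← mul_pow, one_div, inv_mul_cancel₀ hs.ne', one_pow]

lemma aux_mv_phi {d : ℕ} (S : Matrix (Fin d) (Fin d) ℝ) (hS : S.PosDef) (α : Fin d → ℝ)
    (s τ κ : ℝ) (hs : 0 < s) :
    ∫⁻ x, ENNReal.ofReal (s ^ d * mvnPdf S (fun i => s * x i)) *
        ENNReal.ofReal (nCdf (s * (α ⬝ᵥ x + τ) - κ)) =
      ENNReal.ofReal (nCdf ((s * τ - κ) / √(1 + α ⬝ᵥ S *ᵥ α))) := by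
  obtain ⟨B, hB⟩ := aux_factor S hS
  rw [aux_change S hS B hB s hs (fun x => ENNReal.ofReal (nCdf (s * (α ⬝ᵥ x + τ) - κ)))]
  · have e1 : α ⬝ᵥ S *ᵥ α = (B *ᵥ α) ⬝ᵥ (B *ᵥ α) := by
      rw [hB, ← mulVec_mulVec, dotProduct_mulVec, vecMul_transpose]
    rw [e1, ← aux_std_phi]
    refine lintegral_congr fun z => ?_
    congr 3
    rw [dotProduct_smul, dotProduct_mulVec, vecMul_transpose, smul_eq_mul]
    field_simp
    ring
  · refine (aux_measurable_nCdf.comp ?_).ennreal_ofReal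
    have : Continuous fun x : Fin d → ℝ => s * (α ⬝ᵥ x + τ) - κ := by fun_prop
    exact this.measurable

lemma aux_integrable (ν p C : ℝ) (hν : 0 < ν) (hp : 0 ≤ p) (h : ℝ → ℝ) (hh : Measurable h)
    (hC : ∀ v, |h v| ≤ C) :
    IntegrableOn (fun v => v ^ (ν / 2 - 1) * Real.exp (-v) / Real.Gamma (ν / 2) *
      ((2 * v / ν) ^ p * h v)) (Ioi 0) := by
  have h1 := (Real.GammaIntegral_convergent (s := ν / 2 + p) (by positivity)).const_mul
    ((2 / ν) ^ p / Real.Gamma (ν / 2))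
  have h2 := h1.mul_bdd (c := C) (g := h) hh.aestronglyMeasurable
    (Eventually.of_forall fun v => by simpa using hC v)
  refine IntegrableOn.congr_fun h2 (fun v hv => ?_) measurableSet_Ioi
  have hv : 0 < v := hv
  have e1 : (2 * v / ν) ^ p = (2 / ν) ^ p * v ^ p := by
    rw [← Real.mul_rpow (by positivity) hv.le]; congr 1; ring
  have e2 : v ^ (ν / 2 + p - 1) = v ^ (ν / 2 - 1) * v ^ p := by
    rw [← Real.rpow_add hv]; congr 1; ring
  simp only [e1, e2]
  ring

lemma aux_subst {d : ℕ} (S : Matrix (Fin d) (Fin d) ℝ) (hS : S.PosDef) (x : Fin d → ℝ)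
    (c κ ν : ℝ) (hν : 0 < ν) :
    ∫ v in Ioi (0 : ℝ), v ^ (ν / 2 - 1) * Real.exp (-v) / Real.Gamma (ν / 2) *
      ((2 * v / ν) ^ ((d : ℝ) / 2) * (mvnPdf S (fun i => √(2 * v / ν) * x i) *
        nCdf (√(2 * v / ν) * c - κ))) =
    tPdf S ν x * nctCdf (c * √((ν + d) / (ν + x ⬝ᵥ S⁻¹ *ᵥ x))) κ (ν + d) := by
  have hQ : 0 ≤ x ⬝ᵥ S⁻¹ *ᵥ x := by
    simpa using hS.inv.posSemidef.dotProduct_mulVec_nonneg x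
  have hdet := hS.det_pos
  set Q := x ⬝ᵥ S⁻¹ *ᵥ x with hQd
  set b : ℝ := 1 + Q / ν with hb
  have hbp : 0 < b := by positivity
  set g : ℝ → ℝ := fun w => w ^ ((ν + d) / 2 - 1) * Real.exp (-w) / Real.Gamma ((ν + d) / 2) *
      nCdf (c * √((ν + d) / (ν + Q)) * √(2 * w / (ν + d)) - κ) with hg
  have h1 := integral_comp_mul_left_Ioi g 0 hbp
  rw [mul_zero, smul_eq_mul] at h1
  have h2 : nctCdf (c * √((ν + d) / (ν + Q))) κ (ν + d) = b * ∫ v in Ioi 0, g (b * v) := by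
    rw [h1, nctCdf, mul_inv_cancel_left₀ hbp.ne']
  rw [h2, ← mul_assoc, ← integral_const_mul]
  refine setIntegral_congr_fun measurableSet_Ioi fun v hv => ?_
  have hv : 0 < v := hv
  have hνd : 0 < ν + d := by positivity
  simp only [hg]
  have e1 : c * √((ν + d) / (ν + Q)) * √(2 * (b * v) / (ν + d)) = √(2 * v / ν) * c := by
    rw [mul_assoc, ← Real.sqrt_mul (by positivity), mul_comm]
    congr 2
    rw [hb]; field_simp
  have e2 : (fun i => √(2 * v / ν) * x i) = √(2 * v / ν) • x := by ext; simp
  have e3 : (√(2 * v / ν) • x) ⬝ᵥ S⁻¹ *ᵥ (√(2 * v / ν) • x) = 2 * v / ν * Q := by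
    rw [mulVec_smul, dotProduct_smul, smul_dotProduct, smul_eq_mul, smul_eq_mul, ← mul_assoc,
      Real.mul_self_sqrt (by positivity)]
  rw [e1, e2, mvnPdf, e3, tPdf, ← hQd, ← hb, Fintype.card_fin, Real.sqrt_eq_rpow S.det]
  have e4 : rexp (-(b * v)) = rexp (-v) * rexp (-(2 * v / ν * Q) / 2) := by
    rw [← Real.exp_add]; congr 1; rw [hb]; field_simp; ring
  have e5 : (b * v) ^ ((ν + d) / 2 - 1) = b ^ ((ν + d) / 2) * b⁻¹ * (v ^ (ν / 2 - 1) * v ^ ((d : ℝ) / 2)) := by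
    rw [Real.mul_rpow hbp.le hv.le, Real.rpow_sub_one hbp.ne', ← Real.rpow_add hv, div_eq_mul_inv]
    congr 2; ring
  have e6 : b ^ (-(ν + d) / 2) = (b ^ ((ν + d) / 2))⁻¹ := by
    rw [neg_div, Real.rpow_neg hbp.le]
  have e7 : (2 * v / ν) ^ ((d : ℝ) / 2) = 2 ^ ((d : ℝ) / 2) * v ^ ((d : ℝ) / 2) / ν ^ ((d : ℝ) / 2) := by
    rw [Real.div_rpow (by positivity) hν.le, Real.mul_rpow (by positivity) hv.le]
  have e8 : (2 * π) ^ (-(d : ℝ) / 2) = (2 ^ ((d : ℝ) / 2) * π ^ ((d : ℝ) / 2))⁻¹ := by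
    rw [neg_div, Real.rpow_neg (by positivity), Real.mul_rpow (by positivity) (by positivity)]
  have e9 : (ν * π) ^ ((d : ℝ) / 2) = ν ^ ((d : ℝ) / 2) * π ^ ((d : ℝ) / 2) := by
    rw [Real.mul_rpow (by positivity) (by positivity)]
  have e10 : S.det ^ (-(1:ℝ) / 2) = (S.det ^ ((1:ℝ) / 2))⁻¹ := by
    rw [neg_div, Real.rpow_neg hdet.le]
  have e11 : 0 < Real.Gamma ((ν + d) / 2) := Real.Gamma_pos_of_pos (by positivity)
  have e12 : 0 < Real.Gamma (ν / 2) := Real.Gamma_pos_of_pos (by positivity)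
  rw [e4, e5, e6, e7, e8, e9, e10]
  have f1 : b ^ ((ν + d) / 2) ≠ 0 := by positivity
  have f2 : (2:ℝ) ^ ((d : ℝ) / 2) ≠ 0 := by positivity
  have f3 : ν ^ ((d : ℝ) / 2) ≠ 0 := by positivity
  have f4 : π ^ ((d : ℝ) / 2) ≠ 0 := by positivity
  have f5 : S.det ^ ((1:ℝ) / 2) ≠ 0 := by positivity
  generalize b ^ ((ν + d) / 2) = y1 at *
  generalize (2:ℝ) ^ ((d : ℝ) / 2) = y2 at *
  generalize ν ^ ((d : ℝ) / 2) = y3 at *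
  generalize π ^ ((d : ℝ) / 2) = y4 at *
  generalize S.det ^ ((1:ℝ) / 2) = y5 at *
  generalize v ^ ((d : ℝ) / 2) = y6 at *
  generalize v ^ (ν / 2 - 1) = y7 at *
  generalize Real.Gamma ((ν + d) / 2) = y8 at *
  generalize Real.Gamma (ν / 2) = y9 at *
  generalize nCdf (√(2 * v / ν) * c - κ) = y10 at *
  generalize rexp (-(2 * v / ν * Q) / 2) = y11 at *
  generalize rexp (-v) = y12 at *
  have := hbp.ne'
  clear_value b
  field_simp

lemma aux_mvnPdf_nonneg {d : ℕ} (S : Matrix (Fin d) (Fin d) ℝ) (hS : S.PosDef) (y : Fin d → ℝ) :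
    0 ≤ mvnPdf S y := by
  have := hS.det_pos
  unfold mvnPdf; positivity

lemma aux_mvnPdf_le {d : ℕ} (S : Matrix (Fin d) (Fin d) ℝ) (hS : S.PosDef) (y : Fin d → ℝ) :
    mvnPdf S y ≤ mvnPdf S 0 := by
  have := hS.det_pos
  have hQ : 0 ≤ y ⬝ᵥ S⁻¹ *ᵥ y := by
    simpa using hS.inv.posSemidef.dotProduct_mulVec_nonneg y
  unfold mvnPdf
  gcongr
  simpa using hQ

lemma aux_nPdf_le (x : ℝ) : nPdf x ≤ nPdf 0 := by
  unfold nPdf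
  exact mul_le_mul_of_nonneg_left (Real.exp_le_exp.2 (by nlinarith [sq_nonneg x])) (by positivity)

lemma aux_w_nonneg (ν v : ℝ) (hν : 0 < ν) (hv : 0 < v) :
    0 ≤ v ^ (ν / 2 - 1) * Real.exp (-v) / Real.Gamma (ν / 2) := by
  have : 0 < Real.Gamma (ν / 2) := Real.Gamma_pos_of_pos (by positivity)
  positivity

lemma aux_sqrt_pow (t : ℝ) (ht : 0 < t) (d : ℕ) : t ^ ((d : ℝ) / 2) = √t ^ d := by
  rw [Real.sqrt_eq_rpow, ← Real.rpow_natCast, ← Real.rpow_mul ht.le]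
  congr 1; ring

/-- numerator density -/
def auxG {d : ℕ} (S : Matrix (Fin d) (Fin d) ℝ) (α : Fin d → ℝ) (τ κ ν : ℝ) (x : Fin d → ℝ) : ENNReal :=
  ∫⁻ v in Ioi (0 : ℝ), ENNReal.ofReal (v ^ (ν / 2 - 1) * Real.exp (-v) / Real.Gamma (ν / 2) *
      ((2 * v / ν) ^ ((d : ℝ) / 2) * (mvnPdf S (fun i => √(2 * v / ν) * x i) *
        nCdf (√(2 * v / ν) * (α ⬝ᵥ x + τ) - κ))))

lemma aux_meas_dot {d : ℕ} (α : Fin d → ℝ) : Measurable fun x : Fin d → ℝ => α ⬝ᵥ x := by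
  have : Continuous fun x : Fin d → ℝ => α ⬝ᵥ x := by fun_prop
  exact this.measurable

lemma aux_meas_G {d : ℕ} (S : Matrix (Fin d) (Fin d) ℝ) (α : Fin d → ℝ) (τ κ ν : ℝ) :
    Measurable (fun q : (Fin d → ℝ) × ℝ => ENNReal.ofReal (q.2 ^ (ν / 2 - 1) * Real.exp (-q.2) / Real.Gamma (ν / 2) *
      ((2 * q.2 / ν) ^ ((d : ℝ) / 2) * (mvnPdf S (fun i => √(2 * q.2 / ν) * q.1 i) *
        nCdf (√(2 * q.2 / ν) * (α ⬝ᵥ q.1 + τ) - κ))))) := by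
  have h1 : Measurable (fun q : (Fin d → ℝ) × ℝ => mvnPdf S (fun i => √(2 * q.2 / ν) * q.1 i)) :=
    (aux_measurable_mvnPdf S).comp (by fun_prop)
  have h0 : Measurable (fun q : (Fin d → ℝ) × ℝ => α ⬝ᵥ q.1) := (aux_meas_dot α).comp measurable_fst
  have h2 : Measurable (fun q : (Fin d → ℝ) × ℝ => nCdf (√(2 * q.2 / ν) * (α ⬝ᵥ q.1 + τ) - κ)) :=
    aux_measurable_nCdf.comp (by fun_prop)
  fun_prop

lemma aux_G_measurable {d : ℕ} (S : Matrix (Fin d) (Fin d) ℝ) (α : Fin d → ℝ) (τ κ ν : ℝ) :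
    Measurable (auxG S α τ κ ν) := (aux_meas_G S α τ κ ν).lintegral_prod_right'

lemma aux_G_eq {d : ℕ} (S : Matrix (Fin d) (Fin d) ℝ) (hS : S.PosDef) (α : Fin d → ℝ) (τ κ ν : ℝ)
    (hν : 0 < ν) (x : Fin d → ℝ) : auxG S α τ κ ν x =
      ENNReal.ofReal (tPdf S ν x *
        nctCdf ((α ⬝ᵥ x + τ) * √((ν + d) / (ν + x ⬝ᵥ S⁻¹ *ᵥ x))) κ (ν + d)) := by
  rw [← aux_subst S hS x _ κ ν hν, auxG, ofReal_integral_eq_lintegral_ofReal]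
  · refine aux_integrable ν _ (mvnPdf S 0) hν (by positivity)
      (fun v => (mvnPdf S (fun i => √(2 * v / ν) * x i) * nCdf (√(2 * v / ν) * (α ⬝ᵥ x + τ) - κ))) ?_ ?_
    · exact ((aux_measurable_mvnPdf S).comp (by fun_prop)).mul (aux_measurable_nCdf.comp (by fun_prop))
    · intro v
      rw [abs_of_nonneg (mul_nonneg (aux_mvnPdf_nonneg S hS _) (aux_nCdf_nonneg _))]
      exact (mul_le_of_le_one_right (aux_mvnPdf_nonneg S hS _) (aux_nCdf_le_one _)).trans
        (aux_mvnPdf_le S hS _)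
  · filter_upwards [ae_restrict_mem measurableSet_Ioi] with v hv
    have hv : 0 < v := hv
    have := aux_mvnPdf_nonneg S hS (fun i => √(2 * v / ν) * x i)
    have := aux_nCdf_nonneg (√(2 * v / ν) * (α ⬝ᵥ x + τ) - κ)
    have := aux_w_nonneg ν v hν hv
    simp only [Pi.zero_apply]
    positivity

lemma aux_G_inner {d : ℕ} (S : Matrix (Fin d) (Fin d) ℝ) (hS : S.PosDef) (α : Fin d → ℝ) (τ κ ν : ℝ)
    (hν : 0 < ν) (x : Fin d → ℝ) :
    ∫⁻ x0 in Iio (α ⬝ᵥ x + τ), ENNReal.ofReal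
      (∫ v in Set.Ioi (0 : ℝ),
        v ^ (ν / 2 - 1) * Real.exp (-v) / Real.Gamma (ν / 2) *
          ((2 * v / ν) ^ (((d : ℝ) + 1) / 2) *
            (mvnPdf S (fun i => Real.sqrt (2 * v / ν) * x i) *
              nPdf (Real.sqrt (2 * v / ν) * x0 - κ)))) = auxG S α τ κ ν x := by
  have h1 : ∀ x0 : ℝ, ENNReal.ofReal
      (∫ v in Set.Ioi (0 : ℝ),
        v ^ (ν / 2 - 1) * Real.exp (-v) / Real.Gamma (ν / 2) *
          ((2 * v / ν) ^ (((d : ℝ) + 1) / 2) *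
            (mvnPdf S (fun i => Real.sqrt (2 * v / ν) * x i) *
              nPdf (Real.sqrt (2 * v / ν) * x0 - κ)))) =
      ∫⁻ v in Set.Ioi (0 : ℝ), ENNReal.ofReal (v ^ (ν / 2 - 1) * Real.exp (-v) / Real.Gamma (ν / 2) *
          ((2 * v / ν) ^ (((d : ℝ) + 1) / 2) *
            (mvnPdf S (fun i => Real.sqrt (2 * v / ν) * x i) *
              nPdf (Real.sqrt (2 * v / ν) * x0 - κ)))) := by
    intro x0
    rw [ofReal_integral_eq_lintegral_ofReal]
    · refine aux_integrable ν _ (mvnPdf S 0 * nPdf 0) hν (by positivity)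
        (fun v => (mvnPdf S (fun i => √(2 * v / ν) * x i) * nPdf (√(2 * v / ν) * x0 - κ))) ?_ ?_
      · exact ((aux_measurable_mvnPdf S).comp (by fun_prop)).mul (aux_measurable_nPdf.comp (by fun_prop))
      · intro v
        rw [abs_of_nonneg (mul_nonneg (aux_mvnPdf_nonneg S hS _) (aux_nPdf_pos _).le)]
        exact mul_le_mul (aux_mvnPdf_le S hS _) (aux_nPdf_le _) (aux_nPdf_pos _).le
          (aux_mvnPdf_nonneg S hS _)
    · filter_upwards [ae_restrict_mem measurableSet_Ioi] with v hv
      have hv : 0 < v := hv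
      have := aux_mvnPdf_nonneg S hS (fun i => √(2 * v / ν) * x i)
      have := (aux_nPdf_pos (√(2 * v / ν) * x0 - κ)).le
      have := aux_w_nonneg ν v hν hv
      simp only [Pi.zero_apply]
      positivity
  simp_rw [h1]
  rw [lintegral_lintegral_swap, auxG]
  · refine setLIntegral_congr_fun measurableSet_Ioi fun v hv => ?_
    have hv : 0 < v := hv
    have hs : 0 < √(2 * v / ν) := by positivity
    have hw := aux_w_nonneg ν v hν hv
    have hm := aux_mvnPdf_nonneg S hS (fun i => √(2 * v / ν) * x i)
    have h3 : (2 * v / ν) ^ (((d : ℝ) + 1) / 2) = (2 * v / ν) ^ ((d : ℝ) / 2) * √(2 * v / ν) := by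
      rw [Real.sqrt_eq_rpow, ← Real.rpow_add (by positivity)]; congr 1; ring
    have h4 : ∀ x0 : ℝ, ENNReal.ofReal (v ^ (ν / 2 - 1) * Real.exp (-v) / Real.Gamma (ν / 2) *
          ((2 * v / ν) ^ (((d : ℝ) + 1) / 2) *
            (mvnPdf S (fun i => Real.sqrt (2 * v / ν) * x i) *
              nPdf (Real.sqrt (2 * v / ν) * x0 - κ)))) =
        ENNReal.ofReal (v ^ (ν / 2 - 1) * Real.exp (-v) / Real.Gamma (ν / 2) *
          ((2 * v / ν) ^ ((d : ℝ) / 2) *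
            (mvnPdf S (fun i => Real.sqrt (2 * v / ν) * x i)))) *
          ENNReal.ofReal (√(2 * v / ν) * nPdf (Real.sqrt (2 * v / ν) * x0 - κ)) := by
      intro x0
      rw [← ENNReal.ofReal_mul (by positivity), h3]
      congr 1; ring
    simp only [h4]
    rw [lintegral_const_mul, aux_inner _ _ _ hs, ← ENNReal.ofReal_mul (by positivity)]
    · congr 1; ring
    · exact ((aux_measurable_nPdf.comp (by fun_prop)).const_mul _).ennreal_ofReal
  · have h1 : Measurable (fun q : ℝ × ℝ => mvnPdf S (fun i => √(2 * q.2 / ν) * x i)) :=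
      (aux_measurable_mvnPdf S).comp (by fun_prop)
    have h2 : Measurable (fun q : ℝ × ℝ => nPdf (√(2 * q.2 / ν) * q.1 - κ)) :=
      aux_measurable_nPdf.comp (by fun_prop)
    apply Measurable.aemeasurable
    simp only [Function.uncurry_def]
    fun_prop

lemma aux_D_integrable (c κ ν : ℝ) (hν : 0 < ν) : IntegrableOn (fun v =>
    v ^ (ν / 2 - 1) * Real.exp (-v) / Real.Gamma (ν / 2) * nCdf (c * √(2 * v / ν) - κ)) (Ioi 0) := by
  have := aux_integrable ν 0 1 hν le_rfl (fun v => nCdf (c * √(2 * v / ν) - κ))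
    (aux_measurable_nCdf.comp (by fun_prop)) (fun v => by
      rw [abs_of_nonneg (aux_nCdf_nonneg _)]; exact aux_nCdf_le_one _)
  simpa using this

lemma aux_D_pos (c κ ν : ℝ) (hν : 0 < ν) : 0 < nctCdf c κ ν := by
  unfold nctCdf
  have hpos : ∀ v ∈ Ioi (0 : ℝ), 0 < v ^ (ν / 2 - 1) * Real.exp (-v) / Real.Gamma (ν / 2) *
      nCdf (c * √(2 * v / ν) - κ) := by
    intro v hv
    have hv : 0 < v := hv
    have : 0 < Real.Gamma (ν / 2) := Real.Gamma_pos_of_pos (by positivity)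
    have := aux_nCdf_pos (c * √(2 * v / ν) - κ)
    positivity
  rw [setIntegral_pos_iff_support_of_nonneg_ae]
  · refine lt_of_lt_of_le ?_ (measure_mono (s := Ioi (0 : ℝ)) ?_)
    · simp
    · intro v hv
      exact ⟨(hpos v hv).ne', hv⟩
  · filter_upwards [ae_restrict_mem measurableSet_Ioi] with v hv
    exact (hpos v hv).le
  · exact aux_D_integrable c κ ν hν

lemma aux_G_total {d : ℕ} (S : Matrix (Fin d) (Fin d) ℝ) (hS : S.PosDef) (α : Fin d → ℝ) (τ κ ν : ℝ)
    (hν : 0 < ν) : ∫⁻ x, auxG S α τ κ ν x =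
      ENNReal.ofReal (nctCdf (τ / √(1 + α ⬝ᵥ S *ᵥ α)) (κ / √(1 + α ⬝ᵥ S *ᵥ α)) ν) := by
  unfold auxG nctCdf
  rw [lintegral_lintegral_swap (by exact (aux_meas_G S α τ κ ν).aemeasurable),
    ofReal_integral_eq_lintegral_ofReal (aux_D_integrable _ _ ν hν)]
  · refine setLIntegral_congr_fun measurableSet_Ioi fun v hv => ?_
    have hv : 0 < v := hv
    have hs : 0 < √(2 * v / ν) := by positivity
    have hw := aux_w_nonneg ν v hν hv
    have h4 : ∀ x : Fin d → ℝ, ENNReal.ofReal (v ^ (ν / 2 - 1) * Real.exp (-v) / Real.Gamma (ν / 2) *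
          ((2 * v / ν) ^ ((d : ℝ) / 2) *
            (mvnPdf S (fun i => Real.sqrt (2 * v / ν) * x i) *
              nCdf (√(2 * v / ν) * (α ⬝ᵥ x + τ) - κ)))) =
        ENNReal.ofReal (v ^ (ν / 2 - 1) * Real.exp (-v) / Real.Gamma (ν / 2)) *
          (ENNReal.ofReal (√(2 * v / ν) ^ d * mvnPdf S (fun i => √(2 * v / ν) * x i)) *
        ENNReal.ofReal (nCdf (√(2 * v / ν) * (α ⬝ᵥ x + τ) - κ))) := by
      intro x
      have hm := aux_mvnPdf_nonneg S hS (fun i => √(2 * v / ν) * x i)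
      rw [← ENNReal.ofReal_mul (by positivity), ← ENNReal.ofReal_mul (by positivity),
        aux_sqrt_pow _ (by positivity)]
      congr 1; ring
    simp only [h4]
    rw [lintegral_const_mul, aux_mv_phi S hS α _ _ _ hs, ← ENNReal.ofReal_mul hw]
    · congr 3; ring
    · have h0 := aux_meas_dot α
      have h1 : Measurable (fun x : Fin d → ℝ => mvnPdf S (fun i => √(2 * v / ν) * x i)) :=
        (aux_measurable_mvnPdf S).comp (by fun_prop)
      have h2 : Measurable (fun x : Fin d → ℝ => nCdf (√(2 * v / ν) * (α ⬝ᵥ x + τ) - κ)) :=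
        aux_measurable_nCdf.comp (by fun_prop)
      fun_prop
  · filter_upwards [ae_restrict_mem measurableSet_Ioi] with v hv
    exact mul_nonneg (aux_w_nonneg ν v hν hv) (aux_nCdf_nonneg _)

/-- conditioning-type stochastic representation of the non-central
extended skew-t distribution. -/
theorem skewT_conditioning_representation
    (d : ℕ) (Ωb : Matrix (Fin d) (Fin d) ℝ) (hpd : Ωb.PosDef)
    (hdiag : ∀ i, Ωb i i = 1) (α : Fin d → ℝ) (τ κ ν : ℝ) (hν : 0 < ν)
    (μ : Measure ((Fin d → ℝ) × ℝ))
    (hμ : μ = volume.withDensity fun p => ENNReal.ofReal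
      (∫ v in Set.Ioi (0 : ℝ),
        v ^ (ν / 2 - 1) * Real.exp (-v) / Real.Gamma (ν / 2) *
          ((2 * v / ν) ^ (((d : ℝ) + 1) / 2) *
            (mvnPdf Ωb (fun i => Real.sqrt (2 * v / ν) * p.1 i) *
              nPdf (Real.sqrt (2 * v / ν) * p.2 - κ))))) :
    0 < μ {p : (Fin d → ℝ) × ℝ | p.2 < α ⬝ᵥ p.1 + τ} ∧
    ∀ B : Set (Fin d → ℝ), MeasurableSet B →
      (μ {p : (Fin d → ℝ) × ℝ | p.1 ∈ B ∧ p.2 < α ⬝ᵥ p.1 + τ}).toReal /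
          (μ {p : (Fin d → ℝ) × ℝ | p.2 < α ⬝ᵥ p.1 + τ}).toReal =
        ∫ y in B, skewTPdf 0 Ωb α τ κ ν y := by
  have hset : ∀ B : Set (Fin d → ℝ), MeasurableSet B →
      MeasurableSet {p : (Fin d → ℝ) × ℝ | p.1 ∈ B ∧ p.2 < α ⬝ᵥ p.1 + τ} := by
    intro B hB
    have h0 : Measurable (fun q : (Fin d → ℝ) × ℝ => α ⬝ᵥ q.1) :=
      (aux_meas_dot α).comp measurable_fst
    exact (measurable_fst hB).inter (measurableSet_lt measurable_snd (h0.add_const τ))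
  have hnum : ∀ B : Set (Fin d → ℝ), MeasurableSet B →
      μ {p : (Fin d → ℝ) × ℝ | p.1 ∈ B ∧ p.2 < α ⬝ᵥ p.1 + τ} =
        ∫⁻ x in B, auxG Ωb α τ κ ν x := by
    intro B hB
    have hmeas : Measurable (fun p : (Fin d → ℝ) × ℝ => ENNReal.ofReal
      (∫ v in Set.Ioi (0 : ℝ),
        v ^ (ν / 2 - 1) * Real.exp (-v) / Real.Gamma (ν / 2) *
          ((2 * v / ν) ^ (((d : ℝ) + 1) / 2) *
            (mvnPdf Ωb (fun i => Real.sqrt (2 * v / ν) * p.1 i) *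
              nPdf (Real.sqrt (2 * v / ν) * p.2 - κ))))) := by
      apply Measurable.ennreal_ofReal
      have h1 : Measurable (fun q : ((Fin d → ℝ) × ℝ) × ℝ =>
          mvnPdf Ωb (fun i => √(2 * q.2 / ν) * q.1.1 i)) :=
        (aux_measurable_mvnPdf Ωb).comp (by fun_prop)
      have h2 : Measurable (fun q : ((Fin d → ℝ) × ℝ) × ℝ => nPdf (√(2 * q.2 / ν) * q.1.2 - κ)) :=
        aux_measurable_nPdf.comp (by fun_prop)
      have h3 : Measurable (fun q : ((Fin d → ℝ) × ℝ) × ℝ =>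
        q.2 ^ (ν / 2 - 1) * Real.exp (-q.2) / Real.Gamma (ν / 2) *
          ((2 * q.2 / ν) ^ (((d : ℝ) + 1) / 2) *
            (mvnPdf Ωb (fun i => Real.sqrt (2 * q.2 / ν) * q.1.1 i) *
              nPdf (Real.sqrt (2 * q.2 / ν) * q.1.2 - κ)))) := by fun_prop
      exact (h3.stronglyMeasurable.integral_prod_right' (ν := volume.restrict (Ioi 0))).measurable
    rw [hμ, withDensity_apply _ (hset B hB), ← lintegral_indicator (hset B hB),
      Measure.volume_eq_prod, lintegral_prod _ (hmeas.indicator (hset B hB)).aemeasurable,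
      ← lintegral_indicator hB]
    refine lintegral_congr fun x => ?_
    by_cases hx : x ∈ B
    · rw [indicator_of_mem hx, ← aux_G_inner Ωb hpd α τ κ ν hν x,
        ← lintegral_indicator measurableSet_Iio]
      refine lintegral_congr fun x0 => ?_
      simp [indicator, hx]
    · rw [indicator_of_notMem hx]
      simp [indicator, hx]
  set D := nctCdf (τ / √(1 + α ⬝ᵥ Ωb *ᵥ α)) (κ / √(1 + α ⬝ᵥ Ωb *ᵥ α)) ν with hD
  have hDpos : 0 < D := aux_D_pos _ _ _ hν
  have hden : μ {p : (Fin d → ℝ) × ℝ | p.2 < α ⬝ᵥ p.1 + τ} = ENNReal.ofReal D := by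
    have := hnum univ MeasurableSet.univ
    rw [Measure.restrict_univ, aux_G_total Ωb hpd α τ κ ν hν] at this
    simpa using this
  refine ⟨by rw [hden]; simpa using hDpos, fun B hB => ?_⟩
  have hω : (Matrix.diagonal fun i => √(Ωb i i)) = (1 : Matrix (Fin d) (Fin d) ℝ) := by
    simp [hdiag]
  have hskew : ∀ y, skewTPdf 0 Ωb α τ κ ν y = (auxG Ωb α τ κ ν y).toReal / D := by
    intro y
    have hnn : 0 ≤ tPdf Ωb ν y *
        nctCdf ((α ⬝ᵥ y + τ) * √((ν + d) / (ν + y ⬝ᵥ Ωb⁻¹ *ᵥ y))) κ (ν + d) := by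
      refine mul_nonneg ?_ (aux_D_pos _ _ _ (by positivity)).le
      have hQ : 0 ≤ y ⬝ᵥ Ωb⁻¹ *ᵥ y := by
        simpa using hpd.inv.posSemidef.dotProduct_mulVec_nonneg y
      have h1 : 0 < Real.Gamma (ν / 2) := Real.Gamma_pos_of_pos (by positivity)
      have h2 : 0 < Real.Gamma ((ν + Fintype.card (Fin d)) / 2) :=
        Real.Gamma_pos_of_pos (by positivity)
      unfold tPdf
      positivity
    rw [aux_G_eq Ωb hpd α τ κ ν hν, ENNReal.toReal_ofReal hnn, skewTPdf]
    simp only [hω, inv_one, Matrix.one_mul, Matrix.mul_one, Matrix.one_mulVec, Pi.zero_apply,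
      sub_zero, Fintype.card_fin]
    rfl
  simp_rw [hskew]
  rw [integral_div, integral_toReal (aux_G_measurable Ωb α τ κ ν).aemeasurable, hnum B hB, hden,
    ENNReal.toReal_ofReal hDpos.le]
  exact Eventually.of_forall fun y => by rw [aux_G_eq Ωb hpd α τ κ ν hν]; exact ENNReal.ofReal_lt_top
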